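/- arXiv:1506.08547 — 5 statements merged into one kernel-verified Lean document; each statement's English description precedes it below -/
import Mathlib

section
/- Assume λ ∈ ℝ^F satisfies condition (A). Then for every word W = w_1⋯w_t over F and every state σ ∈ Ω, the sum of p(τ) over all walks τ whose flaw word is W and whose final state is σ is at most γ^init·λ_W·ω(σ). Consequently, the sum of p(τ) over all walks τ whose flaw word is W is at most γ^init·λ_W. -/
open scoped Classical

noncomputable section

namespace LLLFormal

/-- A walk: an initial state together with a list of (flaw, next-state) steps. -/
structure Walk (Ω F : Type*) where
  start : Ω
  steps : List (F × Ω)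

variable {Ω F : Type*}

/-- Validity of a list of steps from a given state, w.r.t. a step relation. -/
def ValidFrom (step : F → Ω → Ω → Prop) : Ω → List (F × Ω) → Prop
  | _, [] => True
  | σ, (f, σ') :: rest => step f σ σ' ∧ ValidFrom step σ' rest

/-- The state reached after performing the steps `l` starting from `σ`. -/
def endOf (σ : Ω) (l : List (F × Ω)) : Ω := (l.map Prod.snd).getLastD σ

/-- `τ` is a (valid) walk w.r.t. the step relation `step`. -/
def Walk.Valid (step : F → Ω → Ω → Prop) (τ : Walk Ω F) : Prop := ValidFrom step τ.start τ.steps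

/-- The flaw word of a walk. -/
def Walk.word (τ : Walk Ω F) : List F := τ.steps.map Prod.fst

/-- The final state of a walk. -/
def Walk.final (τ : Walk Ω F) : Ω := endOf τ.start τ.steps

/-- The length of a walk. -/
def Walk.len (τ : Walk Ω F) : ℕ := τ.steps.length

/-- Product of the transition probabilities along a list of steps. -/
def prodRho (ρ : F → Ω → Ω → ℝ) : Ω → List (F × Ω) → ℝ
  | _, [] => 1
  | σ, (f, σ') :: rest => ρ f σ σ' * prodRho ρ σ' rest

/-- The weight `p(τ)` of a walk. -/
def Walk.wt (ωinit : Ω → ℝ) (ρ : F → Ω → Ω → ℝ) (τ : Walk Ω F) : ℝ :=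
  ωinit τ.start * prodRho ρ τ.start τ.steps

/-- `λ_W = ∏_i λ_{w_i}`. -/
def wordWt (lam : F → ℝ) (W : List F) : ℝ := (W.map lam).prod

/-- The data of the objects, flaws, actions and resampling oracles:
`mem f σ` means `σ ∈ f`; `Act f σ` is the action set `A(f,σ)`;
`ρ f σ σ'` is the probability `ρ(σ'|f,σ)`, whose support is exactly `A(f,σ)`. -/
structure Setup (Ω F : Type*) [Fintype Ω] where
  mem : F → Ω → Prop
  flaw_nonempty : ∀ f, ∃ σ, mem f σ
  Act : F → Ω → Set Ω
  act_nonempty : ∀ f σ, mem f σ → (Act f σ).Nonempty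
  ρ : F → Ω → Ω → ℝ
  ρ_nonneg : ∀ f σ σ', 0 ≤ ρ f σ σ'
  ρ_support : ∀ f σ, mem f σ → ∀ σ', (0 < ρ f σ σ' ↔ σ' ∈ Act f σ)
  ρ_total : ∀ f σ, mem f σ → ∑ σ' : Ω, ρ f σ σ' = 1

variable [Fintype Ω]

/-- A valid step `σ →^f σ'`. -/
def Setup.step (S : Setup Ω F) (f : F) (σ σ' : Ω) : Prop := S.mem f σ ∧ σ' ∈ S.Act f σ

/-- A probability distribution on `Ω`. -/
def IsProb (ω : Ω → ℝ) : Prop := (∀ σ, 0 ≤ ω σ) ∧ ∑ σ : Ω, ω σ = 1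

/-- A probability distribution on `Ω` with full support. -/
def IsPosProb (ω : Ω → ℝ) : Prop := (∀ σ, 0 < ω σ) ∧ ∑ σ : Ω, ω σ = 1

/-- `γ^init = max_{σ∈Ω} ωinit σ / ω σ`. -/
def gammaInit [Nonempty Ω] (ωinit ω : Ω → ℝ) : ℝ :=
  Finset.univ.sup' Finset.univ_nonempty fun σ => ωinit σ / ω σ

/-- Condition (A): `λ_f ≥ ∑_{σ ∈ f : σ' ∈ A(f,σ)} ρ(σ'|f,σ) ω(σ)/ω(σ')`. -/
def CondA (S : Setup Ω F) (ω : Ω → ℝ) (lam : F → ℝ) : Prop :=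
  ∀ (f : F) (σ' : Ω),
    lam f ≥ ∑ σ : Ω, if S.mem f σ ∧ σ' ∈ S.Act f σ then S.ρ f σ σ' * ω σ / ω σ' else 0

/-- `(F, ∼)` is a potential causality graph:
for every valid step `σ →^f σ'`, `F_{σ'} ⊆ (F_σ − {f}) ∪ Γ(f)`. -/
def Causality (S : Setup Ω F) (sim : F → F → Prop) : Prop :=
  ∀ f σ σ', S.step f σ σ' → ∀ g, S.mem g σ' → (S.mem g σ ∧ g ≠ f) ∨ sim f g

/-- A finite set of flaws is independent. -/
def IndepF (sim : F → F → Prop) (I : Finset F) : Prop :=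
  ∀ f ∈ I, ∀ g ∈ I, f ≠ g → ¬ sim f g

/-- `B` is a partition of the word `W` into consecutive nonempty blocks of distinct,
pairwise non-neighbouring flaws, with each block contained in `Γ⁺` of the previous one. -/
def StablePartition (sim : F → F → Prop) (B : List (List F)) (W : List F) : Prop :=
  W = B.flatten ∧
  (∀ b ∈ B, b ≠ [] ∧ b.Nodup ∧ b.Pairwise fun f g => ¬ sim f g) ∧
  B.Chain' fun b₁ b₂ => ∀ g ∈ b₂, ∃ f ∈ b₁, f = g ∨ sim f g

/-- A stable word. -/
def StableWord (sim : F → F → Prop) (W : List F) : Prop := ∃ B, StablePartition sim B W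

/-- A stable partition whose blocks are listed in strictly increasing order. -/
def PiStablePartition [LinearOrder F] (sim : F → F → Prop) (B : List (List F))
    (W : List F) : Prop :=
  StablePartition sim B W ∧ ∀ b ∈ B, b.Chain' (· < ·)

/-- A π-stable word. -/
def PiStableWord [LinearOrder F] (sim : F → F → Prop) (W : List F) : Prop :=
  ∃ B, PiStablePartition sim B W

/-- A deterministic strategy: it assigns to every walk whose final state is flawed
a flaw present in the final state. -/
def IsStrategy (S : Setup Ω F) (Λ : Walk Ω F → F) : Prop :=
  ∀ τ : Walk Ω F, Walk.Valid S.step τ → (∃ f, S.mem f (Walk.final τ)) →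
    S.mem (Λ τ) (Walk.final τ)

/-- A walk follows the strategy `Λ`. -/
def Follows (Λ : Walk Ω F → F) (τ : Walk Ω F) : Prop :=
  ∀ (i : ℕ) (h : i < τ.steps.length),
    (τ.steps.get ⟨i, h⟩).1 = Λ ⟨τ.start, τ.steps.take i⟩

/-- The set `Bad(t)` of bad `t`-trajectories. -/
def Bad (S : Setup Ω F) (Λ : Walk Ω F → F) (ωinit : Ω → ℝ) (t : ℕ) : Set (Walk Ω F) :=
  {τ | Walk.Valid S.step τ ∧ Walk.len τ = t ∧ Follows Λ τ ∧ 0 < ωinit τ.start}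

/-- The cluster-expansion condition:
`(λ_f/μ_f) ∑_{S ∈ Ind(Γ(f))} μ(S) ≤ θ` for every flaw `f`. -/
def ClusterCond [Fintype F] (sim : F → F → Prop) (lam μ : F → ℝ) (θ : ℝ) : Prop :=
  ∀ f : F,
    lam f / μ f *
      ∑ I ∈ Finset.univ.filter (fun I : Finset F => (∀ g ∈ I, sim f g) ∧ IndepF sim I),
        ∏ g ∈ I, μ g ≤ θ

/-- `τ` is a prefix of `τ'`. -/
def Walk.IsPrefix (τ τ' : Walk Ω F) : Prop := τ.start = τ'.start ∧ τ.steps <+: τ'.steps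

/-- A valid set of walks: all walks follow one common deterministic strategy,
and no walk is a proper prefix of another one. -/
def ValidSet (S : Setup Ω F) (X : Set (Walk Ω F)) : Prop :=
  (∀ τ ∈ X, Walk.Valid S.step τ) ∧
  (∃ Λ : Walk Ω F → F, IsStrategy S Λ ∧ ∀ τ ∈ X, Follows Λ τ) ∧
  ∀ τ ∈ X, ∀ τ' ∈ X, Walk.IsPrefix τ τ' → τ = τ'

/-- Atomicity of the resampling oracles. -/
def Atomic (S : Setup Ω F) : Prop :=
  ∀ f σ' σ₁ σ₂, S.step f σ₁ σ' → S.step f σ₂ σ' → σ₁ = σ₂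

/-- The map `swap` sends every swappable pair of steps to a valid pair of steps. -/
def SwapValid (S : Setup Ω F) (sim : F → F → Prop) (swap : Ω → F → Ω → F → Ω → Ω) : Prop :=
  ∀ σ₁ f σ₂ g σ₃, S.step f σ₁ σ₂ → S.step g σ₂ σ₃ → ¬ sim f g →
    S.step g σ₁ (swap σ₁ f σ₂ g σ₃) ∧ S.step f (swap σ₁ f σ₂ g σ₃) σ₃

/-- The map `swap` is injective (as a map of two-step walks). -/
def SwapInj (S : Setup Ω F) (sim : F → F → Prop) (swap : Ω → F → Ω → F → Ω → Ω) : Prop :=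
  ∀ σ₁ f σ₂ τ₂ g σ₃, S.step f σ₁ σ₂ → S.step g σ₂ σ₃ → S.step f σ₁ τ₂ → S.step g τ₂ σ₃ →
    ¬ sim f g → swap σ₁ f σ₂ g σ₃ = swap σ₁ f τ₂ g σ₃ → σ₂ = τ₂

/-- The map `swap` preserves the product of the two transition probabilities. -/
def SwapProb (S : Setup Ω F) (sim : F → F → Prop) (swap : Ω → F → Ω → F → Ω → Ω) : Prop :=
  ∀ σ₁ f σ₂ g σ₃, S.step f σ₁ σ₂ → S.step g σ₂ σ₃ → ¬ sim f g →
    S.ρ f σ₁ σ₂ * S.ρ g σ₂ σ₃ =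
      S.ρ g σ₁ (swap σ₁ f σ₂ g σ₃) * S.ρ f (swap σ₁ f σ₂ g σ₃) σ₃

/-- `(ρ, ∼)` is weakly commutative. -/
def WeakComm (S : Setup Ω F) (sim : F → F → Prop) : Prop :=
  ∃ swap, SwapValid S sim swap ∧ SwapInj S sim swap

/-- `(ρ, ∼)` is strongly commutative. -/
def StrongComm (S : Setup Ω F) (sim : F → F → Prop) : Prop :=
  ∃ swap, SwapValid S sim swap ∧ SwapInj S sim swap ∧ SwapProb S sim swap

/-- One valid swap transforming the walk `τ` into the walk `τ'`. -/
def SwapStep (S : Setup Ω F) (sim : F → F → Prop) (swap : Ω → F → Ω → F → Ω → Ω)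
    (τ τ' : Walk Ω F) : Prop :=
  ∃ (A B : List (F × Ω)) (f g : F) (σ₂ σ₃ : Ω),
    f ≠ g ∧ ¬ sim f g ∧
    S.step f (endOf τ.start A) σ₂ ∧ S.step g σ₂ σ₃ ∧
    τ.steps = A ++ (f, σ₂) :: (g, σ₃) :: B ∧
    τ' = ⟨τ.start, A ++ (g, swap (endOf τ.start A) f σ₂ g σ₃) :: (f, σ₃) :: B⟩

/-- `U` is a chain of the walk `τ`. -/
def IsChainOf (sim : F → F → Prop) (U : List F) (τ : Walk Ω F) : Prop :=
  U.Sublist (Walk.word τ) ∧ U.Chain' fun a b => a = b ∨ sim a b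

/-- The longest prefix of `W` ending with `f` (empty if `f` does not occur in `W`). -/
def prefEnd (f : F) (W : List F) : List F :=
  (W.reverse.dropWhile fun x => decide (x ≠ f)).reverse

/-- `W^f_τ` for `f ∈ F ∪ {∅}`. -/
def prefOpt (fo : Option F) (W : List F) : List F :=
  match fo with
  | none => W
  | some f => prefEnd f W

/-- `g ∈ Γ⁺(I)` for a list `I` of flaws. -/
def GammaPlusL (sim : F → F → Prop) (I : List F) (g : F) : Prop := ∃ f ∈ I, f = g ∨ sim f g

/-- The steps of one round, starting at state `σ` with already-addressed flaws `I`: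
each addressed flaw `f` satisfies `f ∈ F_σ − Γ⁺(I)` and the step is valid. -/
def RoundFrom (S : Setup Ω F) (sim : F → F → Prop) : Ω → List F → List (F × Ω) → Prop
  | _, _, [] => True
  | σ, I, (f, σ') :: rest =>
      S.mem f σ ∧ ¬ GammaPlusL sim I f ∧ σ' ∈ S.Act f σ ∧
      RoundFrom S sim σ' (I ++ [f]) rest

/-- Like `RoundFrom`, but the addressed flaw is moreover the `≼`-least of `F_σ − Γ⁺(I)`. -/
def RoundFromPi [LinearOrder F] (S : Setup Ω F) (sim : F → F → Prop) :
    Ω → List F → List (F × Ω) → Prop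
  | _, _, [] => True
  | σ, I, (f, σ') :: rest =>
      S.mem f σ ∧ ¬ GammaPlusL sim I f ∧
      (∀ g, S.mem g σ → ¬ GammaPlusL sim I g → f ≤ g) ∧
      σ' ∈ S.Act f σ ∧ RoundFromPi S sim σ' (I ++ [f]) rest

/-- A walk grouped into rounds: each round is valid, and at the final state of every
round except possibly the last one, `F_σ − Γ⁺(I_r) = ∅`. -/
def RoundsFrom (S : Setup Ω F) (sim : F → F → Prop) : Ω → List (List (F × Ω)) → Prop
  | _, [] => True
  | σ, b :: rest =>
      RoundFrom S sim σ [] b ∧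
      (rest = [] ∨
        ((∀ g, S.mem g (endOf σ b) → GammaPlusL sim (b.map Prod.fst) g) ∧
          RoundsFrom S sim (endOf σ b) rest))

/-- Like `RoundsFrom`, with the `≼`-least flaw selection rule. -/
def RoundsFromPi [LinearOrder F] (S : Setup Ω F) (sim : F → F → Prop) :
    Ω → List (List (F × Ω)) → Prop
  | _, [] => True
  | σ, b :: rest =>
      RoundFromPi S sim σ [] b ∧
      (rest = [] ∨
        ((∀ g, S.mem g (endOf σ b) → GammaPlusL sim (b.map Prod.fst) g) ∧
          RoundsFromPi S sim (endOf σ b) rest))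

/-- The family `Ind^init = ∪_{σ : ωinit σ > 0} Ind(F_σ)`. -/
def indInitSets [Fintype F] (S : Setup Ω F) (sim : F → F → Prop) (ωinit : Ω → ℝ) :
    Finset (Finset F) :=
  Finset.univ.filter fun R => IndepF sim R ∧ ∃ σ, 0 < ωinit σ ∧ ∀ f ∈ R, S.mem f σ

/-- `λ_φ` for a sequence of sets of flaws. -/
def seqWt (lam : F → ℝ) (φ : List (Finset F)) : ℝ := (φ.map fun I => ∏ f ∈ I, lam f).prod

/-- `|φ| = ∑_r |I_r|`. -/
def seqSize (φ : List (Finset F)) : ℕ := (φ.map Finset.card).sum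

/-- A strongly stable sequence. -/
def StronglyStableSeq (sim : F → F → Prop) (φ : List (Finset F)) : Prop :=
  φ ≠ [] ∧ (∀ I ∈ φ, IndepF sim I) ∧
  φ.Chain' (fun I J => ∀ g ∈ J, ∃ f ∈ I, sim f g) ∧
  ∀ I ∈ φ.tail, I ≠ ∅

/-- Membership in `Stab(R,S,t,ℓ)`. -/
def StabRSTL (sim : F → F → Prop) (R S : Finset F) (t ℓ : ℕ) (φ : List (Finset F)) : Prop :=
  φ.head? = some R ∧ φ.length ≤ ℓ ∧ t ≤ seqSize φ ∧
  ((φ.length = 1 ∧ S = ∅) ∨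
    (2 ≤ φ.length ∧ S = φ.tail.headI.filter (fun g => ¬ ∃ f ∈ R, sim f g) ∧
      StronglyStableSeq sim φ.tail))

/-- One valid swap on words. -/
def WordSwap (sim : F → F → Prop) (W W' : List F) : Prop :=
  ∃ (A B : List F) (f g : F), f ≠ g ∧ ¬ sim f g ∧ W = A ++ f :: g :: B ∧ W' = A ++ g :: f :: B

end LLLFormal

namespace LLLFormal

/-- The walk obtained by deleting the first step. -/
def Walk.dropFirst {Ω F : Type*} : Walk Ω F → Walk Ω F
  | ⟨σ, []⟩ => ⟨σ, []⟩
  | ⟨_, (_, σ') :: rest⟩ => ⟨σ', rest⟩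

lemma prodRho_nonneg {Ω F : Type*} {ρ : F → Ω → Ω → ℝ} (hρ : ∀ f σ σ', 0 ≤ ρ f σ σ')
    (σ : Ω) (l : List (F × Ω)) : 0 ≤ prodRho ρ σ l := by
  induction l generalizing σ with
  | nil => exact zero_le_one
  | cons a l ih => exact mul_nonneg (hρ _ _ _) (ih _)

lemma Walk.final_cons {Ω F : Type*} (σ σ' : Ω) (f : F) (l : List (F × Ω)) :
    Walk.final ⟨σ, (f, σ') :: l⟩ = Walk.final ⟨σ', l⟩ := by
  cases l <;> simp [Walk.final, endOf, List.getLast?_cons]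

lemma Walk.exists_of_word_eq_cons {Ω F : Type*} {τ : Walk Ω F} {f : F} {W : List F}
    (h : τ.word = f :: W) :
    ∃ σ σ' l, τ = ⟨σ, (f, σ') :: l⟩ ∧ Walk.word ⟨σ', l⟩ = W := by
  obtain ⟨σ, _ | ⟨⟨g, σ'⟩, l⟩⟩ := τ
  · simp [Walk.word] at h
  · simp only [Walk.word, List.map_cons, List.cons.injEq] at h
    obtain ⟨rfl, h⟩ := h
    exact ⟨σ, σ', l, rfl, h⟩

/-- Pushing a measure `v` on states forward along the valid steps of the flaw `f`. -/
def Setup.push {Ω F : Type*} [Fintype Ω] (S : Setup Ω F) (f : F) (v : Ω → ℝ) (σ' : Ω) : ℝ :=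
  ∑ σ, if S.mem f σ ∧ σ' ∈ S.Act f σ then v σ * S.ρ f σ σ' else 0

lemma Setup.push_nonneg {Ω F : Type*} [Fintype Ω] (S : Setup Ω F) (f : F) {v : Ω → ℝ}
    (hv : ∀ σ, 0 ≤ v σ) (σ' : Ω) : 0 ≤ S.push f v σ' := by
  refine Finset.sum_nonneg fun σ _ => ?_
  split_ifs
  · exact mul_nonneg (hv _) (S.ρ_nonneg _ _ _)
  · exact le_rfl

lemma CondA.push_le {Ω F : Type*} [Fintype Ω] {S : Setup Ω F} {ω : Ω → ℝ} {lam : F → ℝ}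
    (hω : ∀ σ, 0 < ω σ) (hA : CondA S ω lam) {v : Ω → ℝ} {c : ℝ} (hc : 0 ≤ c)
    (hvc : ∀ σ, v σ ≤ c * ω σ) (f : F) (σ' : Ω) : S.push f v σ' ≤ c * lam f * ω σ' := by
  calc S.push f v σ'
      ≤ ∑ σ, c * ω σ' *
          (if S.mem f σ ∧ σ' ∈ S.Act f σ then S.ρ f σ σ' * ω σ / ω σ' else 0) := by
        refine Finset.sum_le_sum fun σ _ => ?_
        split_ifs
        · have h := mul_le_mul_of_nonneg_right (hvc σ) (S.ρ_nonneg f σ σ')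
          have hne := (hω σ').ne'
          calc v σ * S.ρ f σ σ' ≤ c * ω σ * S.ρ f σ σ' := h
            _ = _ := by field_simp
        · simp
    _ = c * ω σ' *
          ∑ σ, (if S.mem f σ ∧ σ' ∈ S.Act f σ then S.ρ f σ σ' * ω σ / ω σ' else 0) := by
        rw [Finset.mul_sum]
    _ ≤ c * ω σ' * lam f :=
        mul_le_mul_of_nonneg_left (hA f σ') (mul_nonneg hc (hω σ').le)
    _ = c * lam f * ω σ' := by ring

lemma CondA.lam_nonneg {Ω F : Type*} [Fintype Ω] [Nonempty Ω] {S : Setup Ω F} {ω : Ω → ℝ}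
    {lam : F → ℝ} (hω : ∀ σ, 0 < ω σ) (hA : CondA S ω lam) (f : F) : 0 ≤ lam f := by
  refine le_trans (Finset.sum_nonneg fun σ _ => ?_) (hA f (Classical.arbitrary Ω))
  split_ifs
  · exact div_nonneg (mul_nonneg (S.ρ_nonneg _ _ _) (hω _).le) (hω _).le
  · exact le_rfl

/-- Deleting the first step turns the total weight of a set of walks whose words begin with `f`
into at most the total weight, with respect to the pushed initial measure, of the tails. -/
lemma sum_wt_le_sum_dropFirst {Ω F : Type*} [Fintype Ω] (S : Setup Ω F) {v : Ω → ℝ}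
    (hv : ∀ σ, 0 ≤ v σ) {f : F} {W : List F} (T : Finset (Walk Ω F))
    (hT : ∀ τ ∈ T, Walk.Valid S.step τ ∧ Walk.word τ = f :: W) :
    ∑ τ ∈ T, Walk.wt v S.ρ τ ≤ ∑ τ ∈ T.image Walk.dropFirst, Walk.wt (S.push f v) S.ρ τ := by
  rw [← Finset.sum_fiberwise_of_maps_to (t := T.image Walk.dropFirst)
    fun τ hτ => Finset.mem_image_of_mem _ hτ]
  refine Finset.sum_le_sum fun τ' _ => ?_
  obtain ⟨σ', l⟩ := τ'
  have hfib : ∀ τ ∈ T.filter (fun τ => τ.dropFirst = ⟨σ', l⟩),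
      τ = ⟨τ.start, (f, σ') :: l⟩ ∧ S.mem f τ.start ∧ σ' ∈ S.Act f τ.start := by
    intro τ hτ
    obtain ⟨hτT, hd⟩ := Finset.mem_filter.1 hτ
    obtain ⟨hval, hw⟩ := hT τ hτT
    obtain ⟨σ, σ₂, l₂, rfl, -⟩ := Walk.exists_of_word_eq_cons hw
    simp only [Walk.dropFirst, Walk.mk.injEq] at hd
    obtain ⟨rfl, rfl⟩ := hd
    exact ⟨rfl, hval.1⟩
  have hinj : Set.InjOn Walk.start
      (T.filter (fun τ => τ.dropFirst = ⟨σ', l⟩) : Set (Walk Ω F)) := by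
    intro a ha b hb hab
    rw [(hfib a ha).1, (hfib b hb).1, hab]
  let g : Ω → ℝ := fun σ =>
    (if S.mem f σ ∧ σ' ∈ S.Act f σ then v σ * S.ρ f σ σ' else 0) * prodRho S.ρ σ' l
  calc ∑ τ ∈ T with τ.dropFirst = ⟨σ', l⟩, Walk.wt v S.ρ τ
      = ∑ τ ∈ T with τ.dropFirst = ⟨σ', l⟩, g τ.start := by
        refine Finset.sum_congr rfl fun τ hτ => ?_
        obtain ⟨h, hs⟩ := hfib τ hτ
        simp only [g, if_pos hs]
        rw [h]
        simp only [Walk.wt, prodRho]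
        ring
    _ = ∑ σ ∈ (T.filter fun τ => τ.dropFirst = ⟨σ', l⟩).image Walk.start, g σ :=
        (Finset.sum_image hinj).symm
    _ ≤ ∑ σ, g σ := by
        refine Finset.sum_le_sum_of_subset_of_nonneg (Finset.subset_univ _) fun σ _ _ => ?_
        refine mul_nonneg ?_ (prodRho_nonneg S.ρ_nonneg _ _)
        split_ifs
        · exact mul_nonneg (hv _) (S.ρ_nonneg _ _ _)
        · exact le_rfl
    _ = Walk.wt (S.push f v) S.ρ ⟨σ', l⟩ := by
        simp only [g, Walk.wt, Setup.push, Finset.sum_mul]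

/-- If the initial measure is dominated by `c • ω`, then any finite set of walks with flaw word `W`
and final state `σ` has total weight at most `c * λ_W * ω σ`. -/
lemma sum_wt_le_of_le {Ω F : Type*} [Fintype Ω] [Nonempty Ω] {S : Setup Ω F} {ω : Ω → ℝ}
    {lam : F → ℝ} (hω : ∀ σ, 0 < ω σ) (hA : CondA S ω lam) (W : List F) (σ : Ω) {v : Ω → ℝ}
    {c : ℝ} (hc : 0 ≤ c) (hv : ∀ σ, 0 ≤ v σ) (hvc : ∀ σ, v σ ≤ c * ω σ)
    (T : Finset (Walk Ω F))
    (hT : ∀ τ ∈ T, Walk.Valid S.step τ ∧ Walk.word τ = W ∧ Walk.final τ = σ) :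
    ∑ τ ∈ T, Walk.wt v S.ρ τ ≤ c * wordWt lam W * ω σ := by
  induction W generalizing v c T with
  | nil =>
    have hsub : T ⊆ {⟨σ, []⟩} := by
      rintro ⟨s, l⟩ hτ
      obtain ⟨-, hw, hf⟩ := hT _ hτ
      obtain rfl : l = [] := by simpa [Walk.word] using hw
      obtain rfl : s = σ := by simpa [Walk.final, endOf] using hf
      exact Finset.mem_singleton_self _
    refine (Finset.sum_le_sum_of_subset_of_nonneg hsub fun τ _ _ =>
      mul_nonneg (hv _) (prodRho_nonneg S.ρ_nonneg _ _)).trans ?_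
    simpa [Walk.wt, prodRho, wordWt] using hvc σ
  | cons f W ih =>
    refine (sum_wt_le_sum_dropFirst S hv T fun τ hτ => ⟨(hT τ hτ).1, (hT τ hτ).2.1⟩).trans ?_
    refine (ih (mul_nonneg hc (hA.lam_nonneg hω f)) (S.push_nonneg f hv)
      (hA.push_le hω hc hvc f) _ fun τ' hτ' => ?_).trans_eq ?_
    · obtain ⟨τ, hτ, rfl⟩ := Finset.mem_image.1 hτ'
      obtain ⟨hval, hw, hfin⟩ := hT τ hτ
      obtain ⟨s, s', l, rfl, hw'⟩ := Walk.exists_of_word_eq_cons hw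
      exact ⟨hval.2, hw', (Walk.final_cons s s' f l).symm.trans hfin⟩
    · simp only [wordWt, List.map_cons, List.prod_cons]
      ring

lemma le_gammaInit_mul {Ω : Type*} [Fintype Ω] [Nonempty Ω] {ω : Ω → ℝ} (ωinit : Ω → ℝ)
    (hω : ∀ σ, 0 < ω σ) (σ : Ω) : ωinit σ ≤ gammaInit ωinit ω * ω σ :=
  (div_le_iff₀ (hω σ)).1 <|
    Finset.le_sup' (fun σ => ωinit σ / ω σ) (Finset.mem_univ σ)

lemma gammaInit_nonneg {Ω : Type*} [Fintype Ω] [Nonempty Ω] {ω ωinit : Ω → ℝ}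
    (hω : ∀ σ, 0 < ω σ) (hinit : ∀ σ, 0 ≤ ωinit σ) : 0 ≤ gammaInit ωinit ω :=
  let σ := Classical.arbitrary Ω
  nonneg_of_mul_nonneg_left ((hinit σ).trans (le_gammaInit_mul ωinit hω σ)) (hω σ)

/-- Lemma "WbracketsSum": under condition (A), for every word `W` and
state `σ`, the total weight of walks with flaw word `W` and final state `σ` is at most
`γ^init · λ_W · ω(σ)`, and the total weight of walks with flaw word `W` is at most
`γ^init · λ_W`. -/
theorem stmt_0 {Ω F : Type*} [Fintype Ω] [Nonempty Ω]
    (S : Setup Ω F) (ω ωinit : Ω → ℝ) (lam : F → ℝ)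
    (hω : IsPosProb ω) (hinit : IsProb ωinit) (hA : CondA S ω lam)
    (W : List F) (σ : Ω)
    (h1 : {τ : Walk Ω F | Walk.Valid S.step τ ∧ Walk.word τ = W ∧ Walk.final τ = σ}.Finite)
    (h2 : {τ : Walk Ω F | Walk.Valid S.step τ ∧ Walk.word τ = W}.Finite) :
    (∑ τ ∈ h1.toFinset, Walk.wt ωinit S.ρ τ) ≤ gammaInit ωinit ω * wordWt lam W * ω σ ∧
    (∑ τ ∈ h2.toFinset, Walk.wt ωinit S.ρ τ) ≤ gammaInit ωinit ω * wordWt lam W := by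
  have key := fun (σ : Ω) => sum_wt_le_of_le hω.1 hA W σ (gammaInit_nonneg hω.1 hinit.1) hinit.1
    (le_gammaInit_mul ωinit hω.1)
  refine ⟨key σ _ fun τ hτ => h1.mem_toFinset.1 hτ, ?_⟩
  rw [← Finset.sum_fiberwise h2.toFinset Walk.final]
  calc ∑ σ, ∑ τ ∈ h2.toFinset with Walk.final τ = σ, Walk.wt ωinit S.ρ τ
      ≤ ∑ σ, gammaInit ωinit ω * wordWt lam W * ω σ := by
        refine Finset.sum_le_sum fun σ _ => key σ _ fun τ hτ => ?_
        obtain ⟨hτ, hf⟩ := Finset.mem_filter.1 hτ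
        obtain ⟨hval, hw⟩ := h2.mem_toFinset.1 hτ
        exact ⟨hval, hw, hf⟩
    _ = gammaInit ωinit ω * wordWt lam W := by
        rw [← Finset.mul_sum, hω.2, mul_one]

end LLLFormal
end
end

section
/- If ρ is atomic, then every walk is uniquely determined by its flaw word together with its final state: if two walks τ = σ_1 →^{w_1} ⋯ →^{w_t} σ_{t+1} and τ' = σ'_1 →^{w_1} ⋯ →^{w_t} σ'_{t+1} have the same flaw word w_1⋯w_t and the same final state σ_{t+1} = σ'_{t+1}, then τ = τ'. -/
open scoped Classical

noncomputable section

namespace LLLFormal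

/-- Two valid lists of steps with the same flaws that end in the same state agree,
including their initial states. -/
theorem ValidFrom.eq_of_map_fst_eq {Ω F : Type*} {step : F → Ω → Ω → Prop}
    (hstep : ∀ f σ' σ₁ σ₂, step f σ₁ σ' → step f σ₂ σ' → σ₁ = σ₂) :
    ∀ {σ₁ σ₂ : Ω} {l₁ l₂ : List (F × Ω)}, ValidFrom step σ₁ l₁ → ValidFrom step σ₂ l₂ →
      l₁.map Prod.fst = l₂.map Prod.fst → endOf σ₁ l₁ = endOf σ₂ l₂ → σ₁ = σ₂ ∧ l₁ = l₂
  | _, _, [], [], _, _, _, hend => ⟨hend, rfl⟩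
  | _, _, [], _ :: _, _, _, hmap, _ => by simp at hmap
  | _, _, _ :: _, [], _, _, hmap, _ => by simp at hmap
  | _, _, (f, a) :: l₁, (g, b) :: l₂, ⟨hf, h₁⟩, ⟨hg, h₂⟩, hmap, hend => by
      obtain ⟨rfl, htail⟩ : f = g ∧ l₁.map Prod.fst = l₂.map Prod.fst := by simpa using hmap
      have hlast : endOf a l₁ = endOf b l₂ := by
        simpa only [endOf, List.map_cons, List.getLastD_cons] using hend
      obtain ⟨rfl, rfl⟩ := ValidFrom.eq_of_map_fst_eq hstep h₁ h₂ htail hlast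
      exact ⟨hstep _ _ _ _ hf hg, rfl⟩

/-- if `ρ` is atomic then a walk is uniquely determined by its flaw word
together with its final state. -/
theorem stmt_2 {Ω F : Type*} [Fintype Ω]
    (S : Setup Ω F) (hatomic : Atomic S)
    (τ τ' : Walk Ω F) (hτ : Walk.Valid S.step τ) (hτ' : Walk.Valid S.step τ')
    (hword : Walk.word τ = Walk.word τ') (hfin : Walk.final τ = Walk.final τ') :
    τ = τ' := by
  obtain ⟨σ, l⟩ := τ
  obtain ⟨σ', l'⟩ := τ'
  obtain ⟨rfl, rfl⟩ := ValidFrom.eq_of_map_fst_eq hatomic hτ hτ' hword hfin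
  rfl

end LLLFormal
end
end

section
/- Suppose (F,∼) is a potential causality graph. Let τ be a walk whose steps are grouped into consecutive rounds 1,…,s such that: within each round, whenever a flaw f is addressed at the current state σ and I denotes the set of flaws already addressed in that round, one has f ∈ F_σ − Γ⁺(I); and at the final state σ of every round r < s one has F_σ − Γ⁺(I_r) = ∅, where I_r denotes the set of flaws addressed in round r. Then the flaws addressed within one round are pairwise distinct, every I_r is independent, and I_{r+1} ⊆ Γ⁺(I_r) for every r < s; hence the flaw word of τ is stable and τ is a stable walk. If moreover at every step the flaw addressed is the ≼_π-least element of F_σ − Γ⁺(I), then within each round the flaws are addressed in strictly increasing ≼_π-order, so τ is a π-stable walk. -/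
open scoped Classical

noncomputable section

namespace LLLFormal

section

variable {Ω F : Type*} [Fintype Ω]

lemma not_gammaPlusL_append_singleton {sim : F → F → Prop} {I : List F} {f g : F}
    (h : ¬ GammaPlusL sim (I ++ [f]) g) : ¬ GammaPlusL sim I g ∧ f ≠ g ∧ ¬ sim f g := by
  refine ⟨fun ⟨a, ha, hag⟩ => h ⟨a, by simp [ha], hag⟩, ?_, ?_⟩
  · exact fun e => h ⟨f, by simp, Or.inl e⟩
  · exact fun e => h ⟨f, by simp, Or.inr e⟩

/-- Every flaw addressed in a round is already present and available when the round starts. -/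
lemma RoundFrom.mem_and_not_gammaPlusL {S : Setup Ω F} {sim : F → F → Prop}
    (hcaus : Causality S sim) {σ : Ω} {I : List F} {l : List (F × Ω)}
    (h : RoundFrom S sim σ I l) :
    ∀ g ∈ l.map Prod.fst, S.mem g σ ∧ ¬ GammaPlusL sim I g := by
  induction l generalizing σ I with
  | nil => simp
  | cons p l ih =>
    obtain ⟨f, σ'⟩ := p
    obtain ⟨hf, hI, hact, hrest⟩ := h
    intro g hg
    rw [List.map_cons, List.mem_cons] at hg
    rcases hg with rfl | hg
    · exact ⟨hf, hI⟩
    · obtain ⟨hg1, hg2⟩ := ih hrest g hg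
      obtain ⟨hgI, -, hsim⟩ := not_gammaPlusL_append_singleton hg2
      rcases hcaus f σ σ' ⟨hf, hact⟩ g hg1 with h | h
      · exact ⟨h.1, hgI⟩
      · exact absurd h hsim

lemma RoundFrom.pairwise {S : Setup Ω F} {sim : F → F → Prop}
    (hcaus : Causality S sim) {σ : Ω} {I : List F} {l : List (F × Ω)}
    (h : RoundFrom S sim σ I l) :
    (l.map Prod.fst).Pairwise fun f g => f ≠ g ∧ ¬ sim f g := by
  induction l generalizing σ I with
  | nil => simp
  | cons p l ih =>
    obtain ⟨f, σ'⟩ := p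
    obtain ⟨-, -, -, hrest⟩ := h
    rw [List.map_cons, List.pairwise_cons]
    exact ⟨fun g hg => (not_gammaPlusL_append_singleton
      (hrest.mem_and_not_gammaPlusL hcaus g hg).2).2, ih hrest⟩

lemma RoundFromPi.roundFrom [LinearOrder F] {S : Setup Ω F} {sim : F → F → Prop}
    {σ : Ω} {I : List F} {l : List (F × Ω)} (h : RoundFromPi S sim σ I l) :
    RoundFrom S sim σ I l := by
  induction l generalizing σ I with
  | nil => trivial
  | cons p l ih => exact ⟨h.1, h.2.1, h.2.2.2.1, ih h.2.2.2.2⟩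

lemma RoundFromPi.pairwise_lt [LinearOrder F] {S : Setup Ω F} {sim : F → F → Prop}
    (hcaus : Causality S sim) {σ : Ω} {I : List F} {l : List (F × Ω)}
    (h : RoundFromPi S sim σ I l) : (l.map Prod.fst).Pairwise (· < ·) := by
  induction l generalizing σ I with
  | nil => simp
  | cons p l ih =>
    have hmem := h.roundFrom.mem_and_not_gammaPlusL hcaus
    have hne := h.roundFrom.pairwise hcaus
    obtain ⟨f, σ'⟩ := p
    obtain ⟨-, -, hmin, -, hrest⟩ := h
    rw [List.map_cons, List.pairwise_cons] at hne ⊢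
    refine ⟨fun g hg => lt_of_le_of_ne ?_ (hne.1 g hg).1, ih hrest⟩
    obtain ⟨hg1, hg2⟩ := hmem g (List.mem_cons_of_mem _ hg)
    exact hmin g hg1 hg2

lemma RoundsFrom.exists_roundFrom {S : Setup Ω F} {sim : F → F → Prop} {σ : Ω}
    {B : List (List (F × Ω))} (h : RoundsFrom S sim σ B) :
    ∀ b ∈ B, ∃ σ', RoundFrom S sim σ' [] b := by
  induction B generalizing σ with
  | nil => simp
  | cons c B ih =>
    obtain ⟨hc, hB⟩ := h
    intro b hb
    rcases List.mem_cons.1 hb with rfl | hb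
    · exact ⟨σ, hc⟩
    · rcases hB with rfl | hB
      · simp at hb
      · exact ih hB.2 b hb

lemma RoundsFromPi.exists_roundFromPi [LinearOrder F] {S : Setup Ω F} {sim : F → F → Prop}
    {σ : Ω} {B : List (List (F × Ω))} (h : RoundsFromPi S sim σ B) :
    ∀ b ∈ B, ∃ σ', RoundFromPi S sim σ' [] b := by
  induction B generalizing σ with
  | nil => simp
  | cons c B ih =>
    obtain ⟨hc, hB⟩ := h
    intro b hb
    rcases List.mem_cons.1 hb with rfl | hb
    · exact ⟨σ, hc⟩
    · rcases hB with rfl | hB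
      · simp at hb
      · exact ih hB.2 b hb

lemma RoundsFrom.isChain {S : Setup Ω F} {sim : F → F → Prop}
    (hcaus : Causality S sim) {σ : Ω} {B : List (List (F × Ω))} (h : RoundsFrom S sim σ B) :
    B.IsChain (fun b₁ b₂ => ∀ g ∈ b₂.map Prod.fst, GammaPlusL sim (b₁.map Prod.fst) g) := by
  induction B generalizing σ with
  | nil => exact List.isChain_nil
  | cons b B ih =>
    obtain ⟨-, hB⟩ := h
    cases B with
    | nil => exact List.isChain_singleton _
    | cons c B =>
      obtain ⟨hend, hrest⟩ := hB.resolve_left (List.cons_ne_nil _ _)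
      rw [List.isChain_cons_cons]
      exact ⟨fun g hg => hend g (hrest.1.mem_and_not_gammaPlusL hcaus g hg).1, ih hrest⟩

/-- In a chain of blocks, only empty blocks can follow an empty block. -/
lemma eq_nil_of_isChain_gammaPlusL {sim : F → F → Prop} {B : List (List F)}
    (h : ([] :: B).IsChain fun b₁ b₂ => ∀ g ∈ b₂, GammaPlusL sim b₁ g) :
    ∀ b ∈ B, b = [] := by
  induction B with
  | nil => simp
  | cons c B ih =>
    rw [List.isChain_cons_cons] at h
    obtain rfl : c = [] := List.eq_nil_iff_forall_not_mem.2 fun g hg => by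
      simpa [GammaPlusL] using h.1 g hg
    simpa using ih h.2

/-- Discarding the empty blocks preserves the chain condition. -/
lemma isChain_gammaPlusL_filter_ne_nil {sim : F → F → Prop} {B : List (List F)}
    (h : B.IsChain fun b₁ b₂ => ∀ g ∈ b₂, GammaPlusL sim b₁ g) :
    (B.filter (· ≠ [])).IsChain fun b₁ b₂ => ∀ g ∈ b₂, GammaPlusL sim b₁ g := by
  induction B with
  | nil => simp
  | cons b B ih =>
    have htail := ih h.tail
    by_cases hb : b = []
    · simpa [hb] using htail
    rw [List.filter_cons_of_pos (by simpa using hb)]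
    cases B with
    | nil => simp
    | cons c B =>
      rw [List.isChain_cons_cons] at h
      by_cases hc : c = []
      · subst hc
        have hnil : ([] :: B).filter (· ≠ []) = [] := by
          simpa using eq_nil_of_isChain_gammaPlusL h.2
        rw [hnil]
        exact List.isChain_singleton _
      · rw [List.filter_cons_of_pos (by simpa using hc)] at htail ⊢
        exact List.isChain_cons_cons.2 ⟨h.1, htail⟩

lemma stablePartition_filter_ne_nil {sim : F → F → Prop} {B : List (List F)}
    (hB : ∀ b ∈ B, b.Nodup ∧ b.Pairwise fun f g => ¬ sim f g)
    (h : B.IsChain fun b₁ b₂ => ∀ g ∈ b₂, GammaPlusL sim b₁ g) :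
    StablePartition sim (B.filter (· ≠ [])) B.flatten := by
  refine ⟨?_, fun b hb => ?_, isChain_gammaPlusL_filter_ne_nil h⟩
  · simpa using List.flatten_filter_ne_nil.symm
  · rw [List.mem_filter] at hb
    exact ⟨by simpa using hb.2, hB b hb.1⟩

end

/-- Proposition "parallel": if `(F,∼)` is a potential causality graph and
the steps of a walk are grouped into rounds as in the parallel algorithm, then the flaws
of each round are distinct and form an independent set, consecutive rounds satisfy
`I_{r+1} ⊆ Γ⁺(I_r)`, and hence the flaw word of the walk is stable; if moreover at each
step the `≼`-least available flaw is chosen, the flaw word is π-stable. -/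
theorem stmt_3 {Ω F : Type*} [Fintype Ω] [LinearOrder F]
    (S : Setup Ω F) (sim : F → F → Prop) (hsym : Symmetric sim) (hcaus : Causality S sim)
    (σ : Ω) (blocks : List (List (F × Ω)))
    (hrounds : RoundsFrom S sim σ blocks) :
    ((∀ b ∈ blocks, (b.map Prod.fst).Nodup ∧
        (b.map Prod.fst).Pairwise fun f g => ¬ sim f g) ∧
      blocks.Chain' (fun b₁ b₂ => ∀ g ∈ b₂.map Prod.fst,
        GammaPlusL sim (b₁.map Prod.fst) g) ∧
      StableWord sim (blocks.flatten.map Prod.fst)) ∧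
    (RoundsFromPi S sim σ blocks →
      (∀ b ∈ blocks, (b.map Prod.fst).Chain' (· < ·)) ∧
      PiStableWord sim (blocks.flatten.map Prod.fst)) := by
  have hblock : ∀ b ∈ blocks, (b.map Prod.fst).Nodup ∧
      (b.map Prod.fst).Pairwise fun f g => ¬ sim f g := fun b hb => by
    obtain ⟨σ', h⟩ := hrounds.exists_roundFrom b hb
    exact List.pairwise_and_iff.1 (h.pairwise hcaus)
  have hchain := hrounds.isChain hcaus
  have hstable : StablePartition sim ((blocks.map (List.map Prod.fst)).filter (· ≠ []))
      (blocks.flatten.map Prod.fst) := by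
    rw [List.map_flatten]
    exact stablePartition_filter_ne_nil (by simpa using hblock) (List.isChain_map _ |>.2 hchain)
  refine ⟨⟨hblock, hchain, _, hstable⟩, fun hpi => ?_⟩
  have hlt : ∀ b ∈ blocks, (b.map Prod.fst).IsChain (· < ·) := fun b hb => by
    obtain ⟨σ', h⟩ := hpi.exists_roundFromPi b hb
    exact (h.pairwise_lt hcaus).isChain
  refine ⟨hlt, _, hstable, fun c hc => ?_⟩
  obtain ⟨b, hb, rfl⟩ := List.mem_map.1 (List.mem_filter.1 hc).1
  exact hlt b hb

end LLLFormal
end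
end

section
/- Suppose (F,∼) is a potential causality graph. If τ is a π-stable walk with flaw word W whose initial state is σ_1, then R_W ⊆ F_{σ_1}; in particular R_W ∈ Ind(F_{σ_1}). -/
open scoped Classical

noncomputable section

namespace LLLFormal

/-- If no flaw of an initial segment of the flaw word of a valid list of steps is a neighbour
of an earlier one, then all the flaws of that segment are present in the initial state. -/
theorem ValidFrom.mem_of_pairwise {Ω F : Type*} [Fintype Ω] {S : Setup Ω F}
    {sim : F → F → Prop} (hcaus : Causality S sim) {b r : List F} {σ : Ω} {l : List (F × Ω)}
    (hl : ValidFrom S.step σ l) (hbr : l.map Prod.fst = b ++ r)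
    (hb : b.Pairwise fun f g => ¬ sim f g) : ∀ f ∈ b, S.mem f σ := by
  induction b generalizing σ l with
  | nil => simp
  | cons f b ih =>
    match l with
    | [] => simp at hbr
    | (f', σ') :: l =>
      obtain ⟨rfl, hbr'⟩ : f' = f ∧ l.map Prod.fst = b ++ r := by simpa using hbr
      obtain ⟨hstep, hl⟩ := hl
      obtain ⟨hfb, hb⟩ := List.pairwise_cons.mp hb
      refine List.forall_mem_cons.mpr ⟨hstep.1, fun g hg => ?_⟩
      exact ((hcaus _ _ _ hstep g (ih hl hbr' hb g hg)).resolve_right (hfb g hg)).1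

/-- Lemma "StableWalkFirstSet": if `(F,∼)` is a potential causality graph
and `τ` is a π-stable walk with flaw word `W`, then the root `R_W` (the flaw set of the
first block) is contained in `F_{σ_1}`; in particular it is an independent subset of
`F_{σ_1}`. -/
theorem stmt_4 {Ω F : Type*} [Fintype Ω] [LinearOrder F]
    (S : Setup Ω F) (sim : F → F → Prop) (hsym : Symmetric sim) (hcaus : Causality S sim)
    (τ : Walk Ω F) (hτ : Walk.Valid S.step τ)
    (B : List (List F)) (hB : PiStablePartition sim B (Walk.word τ)) :
    (∀ f ∈ B.headI, S.mem f τ.start) ∧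
    (B.headI.Pairwise fun f g => ¬ sim f g) := by
  obtain ⟨⟨hW, hblock, -⟩, -⟩ := hB
  cases B with
  | nil => exact ⟨fun _ h => absurd h List.not_mem_nil, List.Pairwise.nil⟩
  | cons b B =>
    have hb := (hblock b List.mem_cons_self).2.2
    exact ⟨ValidFrom.mem_of_pairwise hcaus hτ hW hb, hb⟩

end LLLFormal
end
end

section
/- Assume ρ is atomic, (ρ,∼) is weakly commutative, (F,∼) is a potential causality graph, λ satisfies condition (A), and (λ,μ,θ) satisfy the cluster-expansion condition. Then for every deterministic strategy Λ and every integer t ≥ 0, ∑_{τ∈Bad(t)} p(τ) ≤ γ^init · (∑_{R ∈ Ind^init} μ(R)) · θ^t, where Ind^init = ∪_{σ ∈ Ω : ω^init(σ)>0} Ind(F_σ) and μ(R) = ∏_{f∈R} μ_f. -/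
open scoped Classical

noncomputable section

namespace LLLFormal

/-- There is a walk from `σ` to `σ'` whose flaw word is `W`. -/
def Reach {Ω F : Type*} (step : F → Ω → Ω → Prop) : Ω → List F → Ω → Prop
  | σ, [], σ' => σ = σ'
  | σ, f :: W, σ' => ∃ x, step f σ x ∧ Reach step x W σ'

/-- Two words have the same restriction to every pair of dependent letters. By the projection
criterion, this says that they represent the same trace. -/
def TraceEq {F : Type*} (sim : F → F → Prop) (W W' : List F) : Prop :=
  ∀ a b, (a = b ∨ sim a b) →
    W.filter (fun c => c = a ∨ c = b) = W'.filter (fun c => c = a ∨ c = b)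

/-- Some layer of `φ` contains `f`. -/
def Occurs {F : Type*} (φ : List (Finset F)) (f : F) : Prop :=
  ∃ B ∈ φ, f ∈ B

/-- Some layer of `φ` contains a neighbour of `f`. -/
def Meets {F : Type*} (sim : F → F → Prop) (φ : List (Finset F)) (f : F) : Prop :=
  ∃ h, Occurs φ h ∧ sim h f

/-- Insert `f` in the first layer of `φ` from which on no neighbour of `f` occurs. -/
def layerInsert {F : Type*} (sim : F → F → Prop) (f : F) : List (Finset F) → List (Finset F)
  | [] => [{f}]
  | B :: L => if Meets sim (B :: L) f then B :: layerInsert sim f L else insert f B :: L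

/-- The restriction of a sequence of layers to the letters `a` and `b`. -/
def layerProj {F : Type*} (a b : F) : List (Finset F) → List F
  | [] => []
  | B :: L => (if a ∈ B then [a] else if b ∈ B then [b] else []) ++ layerProj a b L

/-- Nonempty independent layers, each one contained in the neighbourhood of the previous one. -/
def StableLayers {F : Type*} (sim : F → F → Prop) : List (Finset F) → Prop
  | [] => True
  | B :: L => B.Nonempty ∧ IndepF sim B ∧ (∀ g ∈ L.headD ∅, ∃ f ∈ B, sim f g) ∧
      StableLayers sim L

/-- Every final segment of `φ` in which `g` occurs contains a neighbour of `g`. -/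
def Exposed {F : Type*} (sim : F → F → Prop) (g : F) : List (Finset F) → Prop
  | [] => True
  | B :: L => (Occurs (B :: L) g → Meets sim (B :: L) g) ∧ Exposed sim g L

/-- The sequence of layers `φ` is compatible with a walk from `σ₀` to `σ`. -/
structure LayerInv {Ω F : Type*} [Fintype Ω] (S : Setup Ω F) (sim : F → F → Prop)
    (σ₀ σ : Ω) (φ : List (Finset F)) : Prop where
  stable : StableLayers sim φ
  exposed : ∀ g, S.mem g σ → Exposed sim g φ
  present : ∀ g, S.mem g σ → S.mem g σ₀ ∨ Meets sim φ g
  head : ∀ g ∈ φ.headD ∅, S.mem g σ₀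

/-- A list of steps performed after the steps `A` from `s` follows the strategy `Λ`. -/
def FollowsFrom {Ω F : Type*} (Λ : Walk Ω F → F) (s : Ω) :
    List (F × Ω) → List (F × Ω) → Prop
  | _, [] => True
  | A, x :: l => x.1 = Λ ⟨s, A⟩ ∧ FollowsFrom Λ s (A ++ [x]) l

section Walks

variable {Ω F : Type*}

lemma endOf_cons (σ : Ω) (x : F × Ω) (l : List (F × Ω)) :
    endOf σ (x :: l) = endOf x.2 l := by
  simp only [endOf, List.map_cons]
  cases h : l.map Prod.snd <;> simp [List.getLastD]

lemma reach_of_validFrom {step : F → Ω → Ω → Prop} {σ : Ω} {l : List (F × Ω)}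
    (h : ValidFrom step σ l) : Reach step σ (l.map Prod.fst) (endOf σ l) := by
  induction l generalizing σ with
  | nil => rfl
  | cons x l ih =>
    rw [endOf_cons]
    exact ⟨x.2, h.1, ih h.2⟩

lemma followsFrom_of_follows {Λ : Walk Ω F → F} {s : Ω} {l : List (F × Ω)}
    (h : Follows Λ ⟨s, l⟩) : FollowsFrom Λ s [] l := by
  suffices H : ∀ B A, l = A ++ B → FollowsFrom Λ s A B from H l [] rfl
  intro B
  induction B with
  | nil => intros; trivial
  | cons x B ih =>
    intro A hl
    refine ⟨?_, ih _ (by simp [hl])⟩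
    subst hl
    simpa using h A.length (by simp)

end Walks

section Traces

variable {F : Type*} {sim : F → F → Prop}

lemma TraceEq.of_cons {f : F} {W W' : List F} (h : TraceEq sim (f :: W) (f :: W')) :
    TraceEq sim W W' := by
  intro a b hab
  have := h a b hab
  simp only [List.filter_cons] at this
  split_ifs at this
  · exact (List.cons.inj this).2
  · exact this

lemma TraceEq.eq_nil {W : List F} (h : TraceEq sim [] W) : W = [] := by
  cases W with
  | nil => rfl
  | cons f W => simpa using h f f (Or.inl rfl)

lemma TraceEq.exists_split (hsym : Symmetric sim) {f : F} {W W' : List F} (h : TraceEq sim (f :: W) W') :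
    ∃ P Q, W' = P ++ f :: Q ∧ (∀ p ∈ P, ¬ sim p f) ∧ TraceEq sim W (P ++ Q) := by
  have hf : f ∈ W' := by
    have h1 : f ∈ W'.filter (fun c => c = f ∨ c = f) := by
      rw [← h f f (Or.inl rfl)]; simp
    exact (List.mem_filter.1 h1).1
  obtain ⟨P, Q, rfl, hP⟩ := List.eq_append_cons_of_mem hf
  have hns : ∀ p ∈ P, ¬ sim p f := by
    intro p hp hpf
    have h1 := h p f (Or.inr hpf)
    rw [List.filter_append] at h1
    have hne : P.filter (fun c => c = p ∨ c = f) ≠ [] :=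
      List.ne_nil_of_mem (List.mem_filter.2 ⟨hp, by simp⟩)
    obtain ⟨x, xs, hx⟩ := List.exists_cons_of_ne_nil hne
    have hxP : x ∈ P :=
      (List.mem_filter.1 (hx ▸ List.mem_cons_self : x ∈ P.filter _)).1
    rw [hx] at h1
    simp only [List.filter_cons, or_true, decide_true, if_true, List.cons_append] at h1
    exact hP ((List.cons.inj h1).1 ▸ hxP)
  refine ⟨P, Q, rfl, hns, ?_⟩
  intro a b hab
  have h1 := h a b hab
  by_cases hfab : f = a ∨ f = b
  · have hnil : P.filter (fun c => c = a ∨ c = b) = [] := by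
      rw [List.filter_eq_nil_iff]
      intro p hp
      have hpf : p ≠ f := fun e => hP (e ▸ hp)
      have h2 := hns p hp
      simp only [decide_eq_true_eq]
      rintro (rfl | rfl) <;> rcases hfab with rfl | rfl <;> rcases hab with rfl | hab
      all_goals first
        | exact hpf rfl
        | exact h2 hab
        | exact h2 (hsym hab)
    simp only [List.filter_append, List.filter_cons, hfab, decide_true, if_true, hnil,
      List.nil_append] at h1 ⊢
    exact (List.cons.inj h1).2
  · simpa [List.filter_append, List.filter_cons, hfab] using h1

end Traces

section Commutation

variable {Ω F : Type*} [Fintype Ω] {S : Setup Ω F} {sim : F → F → Prop}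

lemma Reach.move_front (hwc : WeakComm S sim) {f : F} {P Q : List F} {σ σ' : Ω}
    (hP : ∀ p ∈ P, ¬ sim p f) (h : Reach S.step σ (P ++ f :: Q) σ') :
    Reach S.step σ (f :: (P ++ Q)) σ' := by
  induction P generalizing σ with
  | nil => exact h
  | cons p P ih =>
    obtain ⟨x, hx, h⟩ := h
    obtain ⟨y, hy, h⟩ := ih (fun q hq => hP q (List.mem_cons_of_mem _ hq)) h
    obtain ⟨swap, hswap, -⟩ := hwc
    obtain ⟨h1, h2⟩ := hswap σ p x f y hx hy (hP p List.mem_cons_self)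
    exact ⟨_, h1, y, h2, h⟩

lemma Reach.start_unique (hsym : Symmetric sim) (hatomic : Atomic S) (hwc : WeakComm S sim)
    {W W' : List F} {σ₁ σ₂ σ' : Ω} (hW : TraceEq sim W W')
    (h₁ : Reach S.step σ₁ W σ') (h₂ : Reach S.step σ₂ W' σ') : σ₁ = σ₂ := by
  induction W generalizing W' σ₁ σ₂ with
  | nil =>
    obtain rfl := hW.eq_nil
    exact Eq.trans h₁ (Eq.symm h₂)
  | cons f W ih =>
    obtain ⟨P, Q, rfl, hP, hPQ⟩ := hW.exists_split hsym
    obtain ⟨x, hx, h₁⟩ := h₁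
    obtain ⟨y, hy, h₂⟩ := h₂.move_front hwc hP
    obtain rfl := ih hPQ h₁ h₂
    exact hatomic f x _ _ hx hy

lemma steps_unique (hsym : Symmetric sim) (hatomic : Atomic S) (hwc : WeakComm S sim)
    {Λ : Walk Ω F → F} {s σ : Ω} {A l l' : List (F × Ω)}
    (hl : ValidFrom S.step σ l) (hl' : ValidFrom S.step σ l')
    (hf : FollowsFrom Λ s A l) (hf' : FollowsFrom Λ s A l')
    (hW : TraceEq sim (l.map Prod.fst) (l'.map Prod.fst)) (hend : endOf σ l = endOf σ l') :
    l = l' := by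
  induction l generalizing l' σ A with
  | nil => exact (List.map_eq_nil_iff.1 hW.eq_nil).symm
  | cons x l ih =>
    cases l' with
    | nil => simpa using hW x.1 x.1 (Or.inl rfl)
    | cons y l' =>
      have hxy : x.1 = y.1 := hf.1.trans hf'.1.symm
      rw [endOf_cons, endOf_cons] at hend
      simp only [List.map_cons, hxy] at hW
      have hW' := hW.of_cons
      have h2 : x.2 = y.2 := Reach.start_unique hsym hatomic hwc hW'
        (reach_of_validFrom hl.2) (hend ▸ reach_of_validFrom hl'.2)
      obtain rfl : x = y := Prod.ext hxy h2
      rw [ih hl.2 hl'.2 hf.2 hf'.2 hW' hend]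

lemma walk_unique (hsym : Symmetric sim) (hatomic : Atomic S) (hwc : WeakComm S sim)
    {Λ : Walk Ω F → F} {τ τ' : Walk Ω F} (hτ : τ.Valid S.step) (hτ' : τ'.Valid S.step)
    (hf : Follows Λ τ) (hf' : Follows Λ τ') (hW : TraceEq sim τ.word τ'.word)
    (hend : τ.final = τ'.final) : τ = τ' := by
  obtain ⟨s, l⟩ := τ
  obtain ⟨s', l'⟩ := τ'
  have h1 := reach_of_validFrom hτ
  have h2 := reach_of_validFrom hτ'
  obtain rfl : s = s' := Reach.start_unique hsym hatomic hwc hW h1 (by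
    rw [show endOf s l = endOf s' l' from hend]; exact h2)
  exact congrArg (Walk.mk s) (steps_unique hsym hatomic hwc hτ hτ' (followsFrom_of_follows hf)
    (followsFrom_of_follows hf') hW hend)

end Commutation

section Layers

variable {F : Type*} {sim : F → F → Prop}

lemma occurs_cons {B : Finset F} {L : List (Finset F)} {g : F} :
    Occurs (B :: L) g ↔ g ∈ B ∨ Occurs L g := by
  simp [Occurs]

lemma occurs_layerInsert {f g : F} {φ : List (Finset F)} :
    Occurs (layerInsert sim f φ) g ↔ g = f ∨ Occurs φ g := by
  induction φ with
  | nil => simp [layerInsert, Occurs]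
  | cons B L ih =>
    rw [layerInsert]
    split_ifs
    · simp only [occurs_cons, ih]; tauto
    · simp only [occurs_cons, Finset.mem_insert]; tauto

lemma meets_layerInsert {f g : F} {φ : List (Finset F)} :
    Meets sim (layerInsert sim f φ) g ↔ sim f g ∨ Meets sim φ g := by
  simp only [Meets, occurs_layerInsert]
  constructor
  · rintro ⟨h, rfl | h', hs⟩
    exacts [Or.inl hs, Or.inr ⟨h, h', hs⟩]
  · rintro (hs | ⟨h, h', hs⟩)
    exacts [⟨f, Or.inl rfl, hs⟩, ⟨h, Or.inr h', hs⟩]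

lemma not_meets_tail {f : F} {B : Finset F} {L : List (Finset F)}
    (h : ¬ Meets sim (B :: L) f) : ¬ Meets sim L f :=
  fun ⟨g, hg, hs⟩ => h ⟨g, occurs_cons.2 (Or.inr hg), hs⟩

lemma not_sim_of_not_meets {f g : F} {φ : List (Finset F)} (h : ¬ Meets sim φ f)
    (hg : Occurs φ g) : ¬ sim g f :=
  fun hs => h ⟨g, hg, hs⟩

lemma exposed_of_not_occurs {g : F} {φ : List (Finset F)} (h : ¬ Occurs φ g) :
    Exposed sim g φ := by
  induction φ with
  | nil => trivial
  | cons B L ih =>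
    exact ⟨fun h' => absurd h' h, ih fun h' => h (occurs_cons.2 (Or.inr h'))⟩

lemma Exposed.layerInsert_of_ne {f g : F} (hne : g ≠ f) {φ : List (Finset F)}
    (h : Exposed sim g φ) : Exposed sim g (layerInsert sim f φ) := by
  induction φ with
  | nil => exact exposed_of_not_occurs (by simpa [layerInsert, Occurs] using hne)
  | cons B L ih =>
    have key : Occurs (layerInsert sim f (B :: L)) g →
        Meets sim (layerInsert sim f (B :: L)) g := by
      rw [occurs_layerInsert, meets_layerInsert]
      rintro (h' | h')
      exacts [absurd h' hne, Or.inr (h.1 h')]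
    rw [layerInsert] at key ⊢
    split_ifs at key ⊢
    exacts [⟨key, ih h.2⟩, ⟨key, h.2⟩]

lemma exposed_layerInsert_of_sim (hsym : Symmetric sim) {f g : F} (hs : sim f g)
    (φ : List (Finset F)) : Exposed sim g (layerInsert sim f φ) := by
  induction φ with
  | nil => exact ⟨fun _ => ⟨f, by simp [Occurs], hs⟩, trivial⟩
  | cons B L ih =>
    have key : Meets sim (layerInsert sim f (B :: L)) g := meets_layerInsert.2 (Or.inl hs)
    rw [layerInsert] at key ⊢
    split_ifs at key ⊢ with hm
    · exact ⟨fun _ => key, ih⟩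
    · exact ⟨fun _ => key, exposed_of_not_occurs fun ho =>
        not_sim_of_not_meets (not_meets_tail hm) ho (hsym hs)⟩

lemma StableLayers.layerInsert (hsym : Symmetric sim) {f : F} {φ : List (Finset F)}
    (h : StableLayers sim φ) : StableLayers sim (layerInsert sim f φ) := by
  induction φ with
  | nil => simp [LLLFormal.layerInsert, StableLayers, IndepF]
  | cons B L ih =>
    obtain ⟨hne, hind, hch, hL⟩ := h
    rw [LLLFormal.layerInsert]
    split_ifs with hm
    · refine ⟨hne, hind, ?_, ih hL⟩
      have hB : ¬ Meets sim L f → ∃ h ∈ B, sim h f := by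
        intro hL'
        obtain ⟨h, ho, hs⟩ := hm
        rcases occurs_cons.1 ho with hb | hb
        exacts [⟨h, hb, hs⟩, absurd ⟨h, hb, hs⟩ hL']
      cases L with
      | nil =>
        intro g hg
        obtain rfl : g = f := by simpa [LLLFormal.layerInsert] using hg
        exact hB (by simp [Meets, Occurs])
      | cons C L =>
        rw [LLLFormal.layerInsert]
        split_ifs with hm'
        · exact hch
        · intro g hg
          rcases Finset.mem_insert.1 hg with rfl | hg
          exacts [hB hm', hch g hg]
    · have hB : ∀ g ∈ B, ¬ sim g f := fun g hg =>
        not_sim_of_not_meets hm (occurs_cons.2 (Or.inl hg))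
      refine ⟨Finset.insert_nonempty _ _, ?_, ?_, hL⟩
      · intro a ha b hb hab
        rw [Finset.mem_insert] at ha hb
        rcases ha with rfl | ha <;> rcases hb with rfl | hb
        · exact absurd rfl hab
        · exact fun hs => hB b hb (hsym hs)
        · exact hB a ha
        · exact hind a ha b hb hab
      · intro g hg
        obtain ⟨x, hx, hs⟩ := hch g hg
        exact ⟨x, Finset.mem_insert_of_mem hx, hs⟩

lemma StableLayers.indepF_head {φ : List (Finset F)} (h : StableLayers sim φ) :
    IndepF sim (φ.headD ∅) := by
  cases φ with
  | nil => simp [IndepF]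
  | cons B L => exact h.2.1

lemma layerProj_eq_nil {a b : F} {φ : List (Finset F)} (ha : ¬ Occurs φ a)
    (hb : ¬ Occurs φ b) : layerProj a b φ = [] := by
  induction φ with
  | nil => rfl
  | cons B L ih =>
    rw [occurs_cons, not_or] at ha hb
    simp [layerProj, ha.1, hb.1, ih ha.2 hb.2]

lemma not_occurs_of_not_meets {f : F} {φ : List (Finset F)} (he : Exposed sim f φ)
    (hm : ¬ Meets sim φ f) : ¬ Occurs φ f := by
  cases φ with
  | nil => simp [Occurs]
  | cons B L => exact fun h => hm (he.1 h)

lemma layerProj_layerInsert (hsym : Symmetric sim) {a b f : F} (hab : a = b ∨ sim a b)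
    {φ : List (Finset F)} (he : Exposed sim f φ) :
    layerProj a b (layerInsert sim f φ) =
      layerProj a b φ ++ [f].filter (fun c => c = a ∨ c = b) := by
  induction φ with
  | nil =>
    by_cases h1 : f = a
    · simp [layerInsert, layerProj, h1]
    · by_cases h2 : f = b
      · simp [layerInsert, layerProj, h2]
      · simp [layerInsert, layerProj, h1, h2, Ne.symm h1, Ne.symm h2]
  | cons B L ih =>
    rw [layerInsert]
    split_ifs with hm
    · rw [layerProj, ih he.2, layerProj, List.append_assoc]
    · have hf := not_occurs_of_not_meets he hm
      by_cases hfab : f = a ∨ f = b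
      · have hno : ∀ c, c = a ∨ c = b → ¬ Occurs (B :: L) c := by
          intro c hc ho
          have hcf := not_sim_of_not_meets hm ho
          rcases hab with rfl | hab
          · grind
          · have := hsym hab
            grind
        have ha := hno a (Or.inl rfl)
        have hb := hno b (Or.inr rfl)
        rw [layerProj_eq_nil ha hb, layerProj]
        rw [occurs_cons, not_or] at ha hb
        rw [layerProj_eq_nil ha.2 hb.2]
        rcases hfab with rfl | rfl
        · simp
        · by_cases h : a = f <;> simp [ha.1, h]
      · rw [not_or] at hfab
        simp [layerProj, Finset.mem_insert, Ne.symm hfab.1, Ne.symm hfab.2, hfab]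

lemma seqWt_layerInsert (lam : F → ℝ) {f : F} {φ : List (Finset F)}
    (he : Exposed sim f φ) : seqWt lam (layerInsert sim f φ) = seqWt lam φ * lam f := by
  simp only [seqWt]
  induction φ with
  | nil => simp [layerInsert]
  | cons B L ih =>
    rw [layerInsert]
    split_ifs with hm
    · simp [ih he.2, mul_assoc]
    · have hf : f ∉ B := fun h => not_occurs_of_not_meets he hm (occurs_cons.2 (Or.inl h))
      rw [List.map_cons, List.prod_cons, Finset.prod_insert hf, List.map_cons, List.prod_cons]
      ring

lemma seqSize_layerInsert {f : F} {φ : List (Finset F)}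
    (he : Exposed sim f φ) : seqSize (layerInsert sim f φ) = seqSize φ + 1 := by
  simp only [seqSize]
  induction φ with
  | nil => simp [layerInsert]
  | cons B L ih =>
    rw [layerInsert]
    split_ifs with hm
    · simp [ih he.2, add_assoc]
    · have hf : f ∉ B := fun h => not_occurs_of_not_meets he hm (occurs_cons.2 (Or.inl h))
      simp [Finset.card_insert_of_notMem hf, add_right_comm]

lemma sum_seqWt_le_of_fiberwise {lam μ : F → ℝ} {c : ℝ} {T : Finset (List (Finset F))}
    {𝓡 : Finset (Finset F)} (hT : ∀ φ ∈ T, φ.headD ∅ ∈ 𝓡)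
    (h : ∀ R, ∑ φ ∈ T with φ.headD ∅ = R, seqWt lam φ ≤ (∏ f ∈ R, μ f) * c) :
    ∑ φ ∈ T, seqWt lam φ ≤ (∑ R ∈ 𝓡, ∏ f ∈ R, μ f) * c := by
  rw [← Finset.sum_fiberwise_of_maps_to hT, Finset.sum_mul]
  exact Finset.sum_le_sum fun R _ => h R

end Layers

section LayersOfWalks

variable {Ω F : Type*} [Fintype Ω] {S : Setup Ω F} {sim : F → F → Prop}

/-- Insert the letters of the word `W`, from left to right, in the layers `φ`. -/
def layersOf (sim : F → F → Prop) (φ : List (Finset F)) (W : List F) : List (Finset F) :=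
  W.foldl (fun φ f => layerInsert sim f φ) φ

lemma LayerInv.nil (S : Setup Ω F) (sim : F → F → Prop) (σ : Ω) :
    LayerInv S sim σ σ [] :=
  ⟨trivial, fun _ _ => trivial, fun _ h => Or.inl h, by simp⟩

lemma LayerInv.step (hsym : Symmetric sim) (hcaus : Causality S sim) {σ₀ σ σ' : Ω} {f : F}
    {φ : List (Finset F)} (h : LayerInv S sim σ₀ σ φ) (hf : S.step f σ σ') :
    LayerInv S sim σ₀ σ' (layerInsert sim f φ) where
  stable := h.stable.layerInsert hsym
  exposed g hg := by
    rcases hcaus f σ σ' hf g hg with ⟨hg, hne⟩ | hs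
    · exact (h.exposed g hg).layerInsert_of_ne hne
    · exact exposed_layerInsert_of_sim hsym hs φ
  present g hg := by
    rw [meets_layerInsert]
    rcases hcaus f σ σ' hf g hg with ⟨hg, -⟩ | hs
    · exact (h.present g hg).imp_right Or.inr
    · exact Or.inr (Or.inl hs)
  head := by
    have hpres : ¬ Meets sim φ f → S.mem f σ₀ := (h.present f hf.1).resolve_right
    have hhead := h.head
    cases φ with
    | nil => simpa [layerInsert] using hpres (by simp [Meets, Occurs])
    | cons B L =>
      rw [layerInsert]
      split_ifs with hm
      · exact hhead
      · intro g hg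
        rcases Finset.mem_insert.1 hg with rfl | hg
        exacts [hpres hm, hhead g hg]

lemma LayerInv.steps (hsym : Symmetric sim) (hcaus : Causality S sim) {σ₀ σ : Ω}
    {φ : List (Finset F)} {l : List (F × Ω)} (h : LayerInv S sim σ₀ σ φ)
    (hl : ValidFrom S.step σ l) :
    LayerInv S sim σ₀ (endOf σ l) (layersOf sim φ (l.map Prod.fst)) ∧
    (∀ lam, seqWt lam (layersOf sim φ (l.map Prod.fst)) =
      seqWt lam φ * wordWt lam (l.map Prod.fst)) ∧
    seqSize (layersOf sim φ (l.map Prod.fst)) = seqSize φ + l.length ∧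
    ∀ a b, (a = b ∨ sim a b) → layerProj a b (layersOf sim φ (l.map Prod.fst)) =
      layerProj a b φ ++ (l.map Prod.fst).filter (fun c => c = a ∨ c = b) := by
  induction l generalizing σ φ with
  | nil => exact ⟨h, by simp [layersOf, wordWt], rfl, by simp [layersOf]⟩
  | cons x l ih =>
    have he := h.exposed x.1 hl.1.1
    obtain ⟨h1, h2, h3, h4⟩ := ih (h.step hsym hcaus hl.1) hl.2
    rw [endOf_cons]
    refine ⟨h1, fun lam => ?_, ?_, fun a b hab => ?_⟩
    · refine (h2 lam).trans ?_
      simp [seqWt_layerInsert lam he, wordWt, mul_assoc]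
    · refine h3.trans ?_
      simp [seqSize_layerInsert he, add_assoc, add_comm 1]
    · refine (h4 a b hab).trans ?_
      rw [layerProj_layerInsert hsym hab he, List.append_assoc, ← List.filter_append]
      rfl

lemma prodRho_mul_le {ω : Ω → ℝ} {lam : F → ℝ} (hω : IsPosProb ω) (hlam : ∀ f, 0 < lam f)
    (hA : CondA S ω lam) {σ : Ω} {l : List (F × Ω)} (hl : ValidFrom S.step σ l) :
    ω σ * prodRho S.ρ σ l ≤ wordWt lam (l.map Prod.fst) * ω (endOf σ l) := by
  induction l generalizing σ with
  | nil => simp [prodRho, wordWt, endOf]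
  | cons x l ih =>
    obtain ⟨f, x⟩ := x
    rw [endOf_cons]
    have hρ : S.ρ f σ x * ω σ ≤ lam f * ω x := by
      rw [← div_le_iff₀ (hω.1 x)]
      refine le_trans ?_ (hA f x)
      have h0 : ∀ y ∈ Finset.univ, (0 : ℝ) ≤
          if S.mem f y ∧ x ∈ S.Act f y then S.ρ f y x * ω y / ω x else 0 := by
        intro y _
        split_ifs
        · exact div_nonneg (mul_nonneg (S.ρ_nonneg _ _ _) (hω.1 y).le) (hω.1 x).le
        · exact le_rfl
      refine le_trans ?_ (Finset.single_le_sum h0 (Finset.mem_univ σ))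
      rw [if_pos ⟨hl.1.1, hl.1.2⟩]
    have hpos : 0 ≤ prodRho S.ρ x l := by
      generalize x = y
      clear * -
      induction l generalizing y with
      | nil => simp [prodRho]
      | cons z l ih => exact mul_nonneg (S.ρ_nonneg _ _ _) (ih _)
    calc ω σ * prodRho S.ρ σ ((f, x) :: l) = S.ρ f σ x * ω σ * prodRho S.ρ x l := by
          rw [prodRho]; ring
      _ ≤ lam f * ω x * prodRho S.ρ x l := mul_le_mul_of_nonneg_right hρ hpos
      _ = lam f * (ω x * prodRho S.ρ x l) := by ring
      _ ≤ lam f * (wordWt lam (l.map Prod.fst) * ω (endOf x l)) :=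
          mul_le_mul_of_nonneg_left (ih hl.2) (hlam f).le
      _ = _ := by simp [wordWt, mul_assoc]

lemma wordWt_nonneg {lam : F → ℝ} (hlam : ∀ f, 0 < lam f) (W : List F) : 0 ≤ wordWt lam W :=
  List.prod_nonneg (by simpa using fun f _ => (hlam f).le)

lemma wt_le [Nonempty Ω] {ω ωinit : Ω → ℝ} {lam : F → ℝ} (hω : IsPosProb ω)
    (hlam : ∀ f, 0 < lam f) (hA : CondA S ω lam) {τ : Walk Ω F} (hτ : τ.Valid S.step)
    (hinit : 0 ≤ ωinit τ.start) :
    τ.wt ωinit S.ρ ≤ gammaInit ωinit ω * (wordWt lam τ.word * ω τ.final) := by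
  have hγ : ωinit τ.start / ω τ.start ≤ gammaInit ωinit ω :=
    Finset.le_sup' (fun σ => ωinit σ / ω σ) (Finset.mem_univ _)
  have hpos := hω.1 τ.start
  calc τ.wt ωinit S.ρ
      = ωinit τ.start / ω τ.start * (ω τ.start * prodRho S.ρ τ.start τ.steps) := by
        rw [Walk.wt]; field_simp
    _ ≤ ωinit τ.start / ω τ.start * (wordWt lam τ.word * ω τ.final) :=
        mul_le_mul_of_nonneg_left (prodRho_mul_le hω hlam hA hτ) (div_nonneg hinit hpos.le)
    _ ≤ _ := mul_le_mul_of_nonneg_right hγ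
        (mul_nonneg (wordWt_nonneg hlam _) (hω.1 _).le)

end LayersOfWalks

section Counting

variable {F : Type*} [Fintype F] {sim : F → F → Prop}

/-- The independent sets all of whose elements have a neighbour in `R`. -/
def indNbrs (sim : F → F → Prop) (R : Finset F) : Finset (Finset F) :=
  Finset.univ.filter fun I => (∀ g ∈ I, ∃ f ∈ R, sim f g) ∧ IndepF sim I

lemma sum_indNbrs_le (μ : F → ℝ) (hμ : ∀ f, 0 < μ f) (R : Finset F) :
    ∑ I ∈ indNbrs sim R, ∏ g ∈ I, μ g ≤
      ∏ f ∈ R, ∑ I ∈ Finset.univ.filter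
        (fun I : Finset F => (∀ g ∈ I, sim f g) ∧ IndepF sim I), ∏ g ∈ I, μ g := by
  induction R using Finset.induction_on with
  | empty =>
    have : indNbrs sim ∅ ⊆ {∅} := by
      intro I hI
      simp only [indNbrs, Finset.mem_filter, Finset.notMem_empty, false_and,
        exists_false] at hI
      exact Finset.mem_singleton.2 (Finset.eq_empty_of_forall_notMem hI.2.1)
    refine (Finset.sum_le_sum_of_subset_of_nonneg this fun I _ _ =>
      Finset.prod_nonneg fun g _ => (hμ g).le).trans ?_
    simp
  | insert f R hf ih =>
    rw [Finset.prod_insert hf]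
    refine le_trans ?_ (mul_le_mul_of_nonneg_left ih
      (Finset.sum_nonneg fun I _ => Finset.prod_nonneg fun g _ => (hμ g).le))
    rw [Finset.sum_mul_sum, ← Finset.sum_product']
    let e : Finset F → Finset F × Finset F := fun I =>
      (I.filter (fun g => sim f g), I.filter (fun g => ¬ sim f g))
    have he : Function.Injective e := by
      intro I J hIJ
      rw [← Finset.filter_union_filter_not_eq (fun g => sim f g) I,
        ← Finset.filter_union_filter_not_eq (fun g => sim f g) J]
      exact congrArg₂ _ (Prod.ext_iff.1 hIJ).1 (Prod.ext_iff.1 hIJ).2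
    have hsum : ∑ I ∈ indNbrs sim (insert f R), ∏ g ∈ I, μ g =
        ∑ x ∈ (indNbrs sim (insert f R)).image e,
          (∏ g ∈ x.1, μ g) * ∏ g ∈ x.2, μ g := by
      rw [Finset.sum_image he.injOn]
      exact Finset.sum_congr rfl fun I _ =>
        (Finset.prod_filter_mul_prod_filter_not I _ _).symm
    rw [hsum]
    refine Finset.sum_le_sum_of_subset_of_nonneg ?_ fun x _ _ =>
      mul_nonneg (Finset.prod_nonneg fun g _ => (hμ g).le)
        (Finset.prod_nonneg fun g _ => (hμ g).le)
    intro x hx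
    obtain ⟨I, hI, rfl⟩ := Finset.mem_image.1 hx
    simp only [indNbrs, Finset.mem_filter, Finset.mem_univ, true_and, Finset.mem_product,
      Finset.mem_insert, exists_eq_or_imp, e] at hI ⊢
    refine ⟨⟨fun g hg => hg.2, ?_⟩, fun g hg => (hI.1 g hg.1).resolve_left hg.2, ?_⟩ <;>
      exact fun a ha b hb => hI.2 a (Finset.mem_filter.1 ha).1 b (Finset.mem_filter.1 hb).1

lemma prod_mul_sum_indNbrs_le {lam μ : F → ℝ} {θ : ℝ} (hlam : ∀ f, 0 < lam f)
    (hμ : ∀ f, 0 < μ f) (hCE : ClusterCond sim lam μ θ) (R : Finset F) :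
    (∏ f ∈ R, lam f) * ∑ I ∈ indNbrs sim R, ∏ g ∈ I, μ g ≤
      (∏ f ∈ R, μ f) * θ ^ R.card := by
  refine (mul_le_mul_of_nonneg_left (sum_indNbrs_le μ hμ R)
    (Finset.prod_nonneg fun f _ => (hlam f).le)).trans ?_
  rw [← Finset.prod_mul_distrib, ← Finset.prod_const, ← Finset.prod_mul_distrib]
  refine Finset.prod_le_prod (fun f _ => mul_nonneg (hlam f).le
    (Finset.sum_nonneg fun I _ => Finset.prod_nonneg fun g _ => (hμ g).le)) fun f _ => ?_
  have h := hCE f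
  rw [div_mul_eq_mul_div, div_le_iff₀ (hμ f)] at h
  rwa [mul_comm (μ f)]

lemma sum_seqWt_le {lam μ : F → ℝ} {θ : ℝ} (hlam : ∀ f, 0 < lam f)
    (hμ : ∀ f, 0 < μ f) (hθ : 0 < θ) (hCE : ClusterCond sim lam μ θ) (n : ℕ)
    (T : Finset (List (Finset F))) (R : Finset F)
    (hT : ∀ φ ∈ T, StableLayers sim φ ∧ seqSize φ = n ∧ φ.headD ∅ = R) :
    ∑ φ ∈ T, seqWt lam φ ≤ (∏ f ∈ R, μ f) * θ ^ n := by
  induction n using Nat.strong_induction_on generalizing T R with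
  | _ n ih =>
  have hnonneg : 0 ≤ (∏ f ∈ R, μ f) * θ ^ n :=
    mul_nonneg (Finset.prod_nonneg fun f _ => (hμ f).le) (pow_pos hθ n).le
  rcases T.eq_empty_or_nonempty with rfl | ⟨φ₀, hφ₀⟩
  · simpa using hnonneg
  rcases R.eq_empty_or_nonempty with rfl | hR
  · have hnil : ∀ φ ∈ T, φ = [] := by
      intro φ hφ
      obtain ⟨h1, -, h3⟩ := hT φ hφ
      cases φ with
      | nil => rfl
      | cons B L => exact absurd h3 h1.1.ne_empty
    obtain rfl : T = {[]} := Finset.eq_singleton_iff_unique_mem.2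
      ⟨hnil φ₀ hφ₀ ▸ hφ₀, hnil⟩
    have : n = 0 := ((hT [] (by simp)).2.1).symm
    simp [this, seqWt]
  · have hcons : ∀ φ ∈ T, φ = R :: φ.tail := by
      intro φ hφ
      obtain ⟨-, -, h3⟩ := hT φ hφ
      cases φ with
      | nil => exact absurd h3.symm hR.ne_empty
      | cons B L => simpa using h3
    have hinj : Set.InjOn List.tail (T : Set (List (Finset F))) := by
      intro φ hφ ψ hψ h
      rw [hcons φ hφ, hcons ψ hψ, h]
    have hsize : ∀ φ ∈ T, R.card + seqSize φ.tail = n := by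
      intro φ hφ
      rw [← (hT φ hφ).2.1, hcons φ hφ]
      simp [seqSize]
    obtain ⟨m, hm⟩ : ∃ m, R.card + m = n := ⟨_, hsize φ₀ hφ₀⟩
    have hmn : m < n := by have := hR.card_pos; omega
    have htail : ∀ ψ ∈ T.image List.tail, StableLayers sim ψ ∧ seqSize ψ = m ∧
        ψ.headD ∅ ∈ indNbrs sim R := by
      intro ψ hψ
      obtain ⟨φ, hφ, rfl⟩ := Finset.mem_image.1 hψ
      have h1 := (hT φ hφ).1
      have h2 := hsize φ hφ
      rw [hcons φ hφ] at h1
      obtain ⟨-, -, h3, h4⟩ := h1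
      exact ⟨h4, by omega, Finset.mem_filter.2 ⟨Finset.mem_univ _, h3, h4.indepF_head⟩⟩
    have hsum : ∑ φ ∈ T, seqWt lam φ =
        (∏ f ∈ R, lam f) * ∑ ψ ∈ T.image List.tail, seqWt lam ψ := by
      rw [Finset.sum_image hinj, Finset.mul_sum]
      refine Finset.sum_congr rfl fun φ hφ => ?_
      conv_lhs => rw [hcons φ hφ]
      simp [seqWt]
    have hbound := sum_seqWt_le_of_fiberwise (lam := lam) (μ := μ) (c := θ ^ m)
      (fun ψ hψ => (htail ψ hψ).2.2) fun R' => ih m hmn _ R' fun ψ hψ => by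
        obtain ⟨h1, h2⟩ := Finset.mem_filter.1 hψ
        exact ⟨(htail ψ h1).1, (htail ψ h1).2.1, h2⟩
    calc ∑ φ ∈ T, seqWt lam φ
        ≤ (∏ f ∈ R, lam f) * ((∑ I ∈ indNbrs sim R, ∏ g ∈ I, μ g) * θ ^ m) := by
          rw [hsum]
          exact mul_le_mul_of_nonneg_left hbound
            (Finset.prod_nonneg fun f _ => (hlam f).le)
      _ ≤ (∏ f ∈ R, μ f) * θ ^ R.card * θ ^ m := by
          rw [← mul_assoc]
          exact mul_le_mul_of_nonneg_right (prod_mul_sum_indNbrs_le hlam hμ hCE R)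
            (pow_pos hθ m).le
      _ = (∏ f ∈ R, μ f) * θ ^ n := by rw [← hm, pow_add, mul_assoc]

end Counting

end LLLFormal

namespace LLLFormal

/-- Theorem 1(b): if `ρ` is atomic and `(ρ,∼)` is weakly commutative, then
for every deterministic strategy,
`∑_{τ∈Bad(t)} p(τ) ≤ γ^init (∑_{R∈Ind^init} μ(R)) θ^t`. -/
theorem stmt_6 {Ω F : Type*} [Fintype Ω] [Nonempty Ω] [Fintype F]
    (S : Setup Ω F) (sim : F → F → Prop) (hsym : Symmetric sim) (hcaus : Causality S sim)
    (hatomic : Atomic S) (hwc : WeakComm S sim)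
    (ω ωinit : Ω → ℝ) (hω : IsPosProb ω) (hinit : IsProb ωinit)
    (lam μ : F → ℝ) (θ : ℝ)
    (hlam : ∀ f, 0 < lam f) (hμ : ∀ f, 0 < μ f) (hθ0 : 0 < θ) (hθ1 : θ < 1)
    (hA : CondA S ω lam) (hCE : ClusterCond sim lam μ θ)
    (Λ : Walk Ω F → F) (hΛ : IsStrategy S Λ) (t : ℕ)
    (hfin : (Bad S Λ ωinit t).Finite) :
    (∑ τ ∈ hfin.toFinset, Walk.wt ωinit S.ρ τ) ≤
      gammaInit ωinit ω * (∑ R ∈ indInitSets S sim ωinit, ∏ f ∈ R, μ f) * θ ^ t := by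
  set D := hfin.toFinset
  have hD : ∀ τ ∈ D, τ.Valid S.step ∧ τ.len = t ∧ Follows Λ τ ∧ 0 < ωinit τ.start :=
    fun τ hτ => hfin.mem_toFinset.1 hτ
  let layers : Walk Ω F → List (Finset F) := fun τ => layersOf sim [] τ.word
  have hlayers := fun τ (hτ : τ ∈ D) =>
    (LayerInv.nil S sim τ.start).steps hsym hcaus (hD τ hτ).1
  have hwt : ∀ τ ∈ D, wordWt lam τ.word = seqWt lam (layers τ) := fun τ hτ => by
    refine Eq.trans ?_ ((hlayers τ hτ).2.1 lam).symm
    simp [seqWt, Walk.word]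
  have hinj : Set.InjOn (fun τ => (layers τ, τ.final)) (D : Set (Walk Ω F)) := by
    intro τ hτ τ' hτ' h
    obtain ⟨h1, h2⟩ := Prod.ext_iff.1 h
    refine walk_unique hsym hatomic hwc (hD τ hτ).1 (hD τ' hτ').1 (hD τ hτ).2.2.1
      (hD τ' hτ').2.2.1 (fun a b hab => ?_) h2
    have e := (hlayers τ hτ).2.2.2 a b hab
    have e' := (hlayers τ' hτ').2.2.2 a b hab
    exact e.symm.trans ((congrArg _ h1).trans e')
  have hseq : ∀ φ ∈ D.image layers, 0 ≤ seqWt lam φ := by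
    intro φ hφ
    obtain ⟨τ, hτ, rfl⟩ := Finset.mem_image.1 hφ
    exact hwt τ hτ ▸ wordWt_nonneg hlam _
  have hγ : 0 ≤ gammaInit ωinit ω := by
    obtain ⟨σ⟩ := ‹Nonempty Ω›
    exact (div_nonneg (hinit.1 σ) (hω.1 σ).le).trans
      (Finset.le_sup' (fun σ => ωinit σ / ω σ) (Finset.mem_univ σ))
  have hcount : ∑ φ ∈ D.image layers, seqWt lam φ ≤
      (∑ R ∈ indInitSets S sim ωinit, ∏ f ∈ R, μ f) * θ ^ t := by
    have hprop : ∀ φ ∈ D.image layers, StableLayers sim φ ∧ seqSize φ = t ∧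
        φ.headD ∅ ∈ indInitSets S sim ωinit := by
      intro φ hφ
      obtain ⟨τ, hτ, rfl⟩ := Finset.mem_image.1 hφ
      obtain ⟨h1, -, h2, -⟩ := hlayers τ hτ
      refine ⟨h1.stable, ?_, ?_⟩
      · rw [← (hD τ hτ).2.1]
        exact h2.trans (by simp [seqSize, Walk.len])
      · exact Finset.mem_filter.2 ⟨Finset.mem_univ _, h1.stable.indepF_head,
          τ.start, (hD τ hτ).2.2.2, h1.head⟩
    refine sum_seqWt_le_of_fiberwise (fun φ hφ => (hprop φ hφ).2.2) fun R => ?_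
    refine sum_seqWt_le hlam hμ hθ0 hCE t _ R fun φ hφ => ?_
    obtain ⟨h1, h2⟩ := Finset.mem_filter.1 hφ
    exact ⟨(hprop φ h1).1, (hprop φ h1).2.1, h2⟩
  calc ∑ τ ∈ D, Walk.wt ωinit S.ρ τ
      ≤ ∑ τ ∈ D, gammaInit ωinit ω * (seqWt lam (layers τ) * ω τ.final) :=
        Finset.sum_le_sum fun τ hτ =>
          hwt τ hτ ▸ wt_le hω hlam hA (hD τ hτ).1 (hinit.1 _)
    _ = gammaInit ωinit ω * ∑ x ∈ D.image (fun τ => (layers τ, τ.final)),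
          seqWt lam x.1 * ω x.2 := by
        rw [← Finset.mul_sum, Finset.sum_image hinj]
    _ ≤ gammaInit ωinit ω * ∑ x ∈ D.image layers ×ˢ Finset.univ,
          seqWt lam x.1 * ω x.2 := by
        refine mul_le_mul_of_nonneg_left (Finset.sum_le_sum_of_subset_of_nonneg ?_ ?_) hγ
        · intro x hx
          obtain ⟨τ, hτ, rfl⟩ := Finset.mem_image.1 hx
          exact Finset.mem_product.2 ⟨Finset.mem_image_of_mem _ hτ, Finset.mem_univ _⟩
        · exact fun x hx _ =>
            mul_nonneg (hseq _ (Finset.mem_product.1 hx).1) (hω.1 _).le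
    _ = gammaInit ωinit ω * ∑ φ ∈ D.image layers, seqWt lam φ := by
        simp only [Finset.sum_product, ← Finset.mul_sum, hω.2, mul_one]
    _ ≤ gammaInit ωinit ω * ((∑ R ∈ indInitSets S sim ωinit, ∏ f ∈ R, μ f) * θ ^ t) :=
        mul_le_mul_of_nonneg_left hcount hγ
    _ = _ := by rw [mul_assoc]

end LLLFormal
end
end
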